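/- In R_n, for all nonempty subsets S, T ⊆ {1,…,n} with S ∩ T ≠ ∅ and all integers a ≥ |S|−1 and b ≥ |T|−1, one has D_{S,a}·D_{T,b} = D_{S∪T, a+b}. -/

import Mathlib

open MvPolynomial

/-- The generators of the algebra `R_n`: one generator `ψ_i` for each `i ∈ {1,…,n}` and one
generator `D_{ij} = D_{ji}` for each 2-element subset `{i,j} ⊆ {1,…,n}`. -/
abbrev Gen (n : ℕ) : Type := Fin n ⊕ {p : Sym2 (Fin n) // ¬ p.IsDiag}

/-- The polynomial generator corresponding to `ψ_i`. -/
noncomputable def Ppsi {n : ℕ} (i : Fin n) : MvPolynomial (Gen n) ℚ := X (Sum.inl i)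

/-- The polynomial generator corresponding to `D_{ij}` (for `i ≠ j`; junk value `0` if
`i = j`). -/
noncomputable def PD {n : ℕ} (i j : Fin n) : MvPolynomial (Gen n) ℚ :=
  if h : i = j then 0
  else X (Sum.inr ⟨s(i, j), fun hd => h (Sym2.mk_isDiag_iff.mp hd)⟩)

/-- The ideal of relations of `R_n`: `D_{ij}ψ_i = −D_{ij}²` for all `i ≠ j` (which by the
symmetry `D_{ij} = D_{ji}` of the generators also gives `D_{ij}ψ_j = −D_{ij}²`), and
`D_{ij}D_{ik} = D_{ij}D_{jk} = D_{ik}D_{jk}` for pairwise distinct `i, j, k`. -/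
noncomputable def relIdeal (n : ℕ) : Ideal (MvPolynomial (Gen n) ℚ) :=
  Ideal.span
    ({p | ∃ i j : Fin n, i ≠ j ∧ p = PD i j * Ppsi i + PD i j ^ 2} ∪
     {p | ∃ i j k : Fin n, i ≠ j ∧ i ≠ k ∧ j ≠ k ∧
        (p = PD i j * PD i k - PD i j * PD j k ∨
         p = PD i j * PD i k - PD i k * PD j k)})

/-- The commutative `ℚ`-algebra `R_n`, generated by `ψ₁, …, ψ_n` and `D_{ij} = D_{ji}`
subject to the relations `D_{ij}ψ_i = D_{ij}ψ_j = −D_{ij}²` and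
`D_{ij}D_{ik} = D_{ij}D_{jk} = D_{ik}D_{jk}` (the universal relations among diagonal and
cotangent line classes on `M_{g|n}`). -/
abbrev Rring (n : ℕ) : Type := MvPolynomial (Gen n) ℚ ⧸ relIdeal n

/-- The class `ψ_i ∈ R_n`. -/
noncomputable def psiCl {n : ℕ} (i : Fin n) : Rring n :=
  Ideal.Quotient.mk (relIdeal n) (Ppsi i)

/-- The class `D_{ij} ∈ R_n`. -/
noncomputable def DCl {n : ℕ} (i j : Fin n) : Rring n :=
  Ideal.Quotient.mk (relIdeal n) (PD i j)

/-- The class `D_{S,a} ∈ R_n`, relative to a choice of `i ∈ S`: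
`D_{S,a} = (−1)^{|S|−1} · (∏_{j ∈ S, j ≠ i} D_{ij}) · ψ_i^{a−|S|+1}`; for `S = {i}` this is
`ψ_i^a`.  (Meaningful for `i ∈ S` and `a ≥ |S| − 1`.) -/
noncomputable def DSa {n : ℕ} (S : Finset (Fin n)) (a : ℕ) (i : Fin n) : Rring n :=
  (-1) ^ (S.card - 1) * (∏ j ∈ S.erase i, DCl i j) * psiCl i ^ (a + 1 - S.card)

lemma DCl_comm {n : ℕ} (i j : Fin n) : DCl i j = DCl j i := by
  unfold DCl PD
  by_cases h : i = j
  · simp [h]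
  · simp [h, Ne.symm h, Sym2.eq_swap]

lemma DCl_mul_psiCl {n : ℕ} {i j : Fin n} (h : i ≠ j) :
    DCl i j * psiCl i = -DCl i j ^ 2 := by
  rw [← add_eq_zero_iff_eq_neg]
  exact Ideal.Quotient.eq_zero_iff_mem.mpr (Ideal.subset_span (Or.inl ⟨i, j, h, rfl⟩))

lemma DCl_mul_DCl {n : ℕ} {i j k : Fin n} (hij : i ≠ j) (hik : i ≠ k) (hjk : j ≠ k) :
    DCl i j * DCl i k = DCl i j * DCl j k := by
  rw [← sub_eq_zero]
  exact Ideal.Quotient.eq_zero_iff_mem.mpr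
    (Ideal.subset_span (Or.inr ⟨i, j, k, hij, hik, hjk, Or.inl rfl⟩))

/-- The signed diagonal class: `-D_{ij}` for `i ≠ j`, and `1` for `i = j`. -/
noncomputable def signedDiag {n : ℕ} (i j : Fin n) : Rring n :=
  if i = j then 1 else -DCl i j

lemma signedDiag_comm {n : ℕ} (i j : Fin n) : signedDiag i j = signedDiag j i := by
  simp [signedDiag, DCl_comm i j, eq_comm]

lemma signedDiag_mul_psiCl {n : ℕ} (i j : Fin n) :
    signedDiag i j * psiCl i = signedDiag i j * psiCl j := by
  by_cases h : i = j
  · rw [h]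
  · have h1 := DCl_mul_psiCl h
    have h2 := DCl_mul_psiCl (Ne.symm h)
    rw [DCl_comm j i] at h2
    simp only [signedDiag, if_neg h]
    linear_combination h2 - h1

lemma signedDiag_mul_psiCl_pow {n : ℕ} (i j : Fin n) (m : ℕ) :
    signedDiag i j * psiCl i ^ m = signedDiag i j * psiCl j ^ m := by
  induction m with
  | zero => simp
  | succ m ih =>
    rw [pow_succ, pow_succ]
    linear_combination psiCl i * ih + psiCl j ^ m * signedDiag_mul_psiCl i j

lemma signedDiag_mul_self {n : ℕ} {i j : Fin n} (h : i ≠ j) :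
    signedDiag i j * signedDiag i j = signedDiag i j * psiCl i := by
  simp only [signedDiag, if_neg h]
  linear_combination DCl_mul_psiCl h

lemma signedDiag_mul_signedDiag {n : ℕ} {i j k : Fin n} (hij : i ≠ j) (hik : i ≠ k)
    (hjk : j ≠ k) :
    signedDiag i j * signedDiag i k = signedDiag i j * signedDiag j k := by
  simp only [signedDiag, if_neg hij, if_neg hik, if_neg hjk]
  linear_combination DCl_mul_DCl hij hik hjk

lemma signedDiag_mul_prod {n : ℕ} {i k : Fin n} (hik : i ≠ k) (U : Finset (Fin n))
    (hi : i ∉ U) (hk : k ∉ U) :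
    signedDiag i k * ∏ j ∈ U, signedDiag i j = signedDiag i k * ∏ j ∈ U, signedDiag k j := by
  induction U using Finset.induction_on with
  | empty => simp
  | insert x U hx ih =>
    simp only [Finset.mem_insert, not_or] at hi hk
    rw [Finset.prod_insert hx, Finset.prod_insert hx]
    linear_combination signedDiag i x * ih hi.2 hk.2 +
      (∏ j ∈ U, signedDiag k j) * signedDiag_mul_signedDiag hik hi.1 hk.1

lemma prod_signedDiag_eq {n : ℕ} {S : Finset (Fin n)} {i k : Fin n} (hi : i ∈ S) (hk : k ∈ S) :
    ∏ j ∈ S, signedDiag i j = ∏ j ∈ S, signedDiag k j := by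
  by_cases hik : i = k
  · rw [hik]
  · have hk' : k ∈ S.erase i := Finset.mem_erase.mpr ⟨Ne.symm hik, hk⟩
    have split (l : Fin n) : ∏ j ∈ S, signedDiag l j =
        signedDiag l i * (signedDiag l k * ∏ j ∈ (S.erase i).erase k, signedDiag l j) := by
      rw [Finset.mul_prod_erase _ _ hk', Finset.mul_prod_erase _ _ hi]
    have self (l : Fin n) : signedDiag l l = 1 := by simp [signedDiag]
    rw [split i, split k, self, self, one_mul, one_mul, signedDiag_comm k i]
    exact signedDiag_mul_prod hik _ (by simp) (by simp)

lemma DSa_eq_prod_signedDiag {n : ℕ} {S : Finset (Fin n)} (a : ℕ) {i : Fin n} (hi : i ∈ S) :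
    DSa S a i = (∏ j ∈ S, signedDiag i j) * psiCl i ^ (a + 1 - S.card) := by
  have h : ∏ j ∈ S.erase i, signedDiag i j =
      (-1) ^ (S.card - 1) * ∏ j ∈ S.erase i, DCl i j := by
    rw [← Finset.card_erase_of_mem hi, ← Finset.prod_const, ← Finset.prod_mul_distrib]
    refine Finset.prod_congr rfl fun j hj => ?_
    rw [signedDiag, if_neg (Finset.ne_of_mem_erase hj).symm]
    ring
  rw [← Finset.mul_prod_erase S _ hi, h]
  simp [DSa, signedDiag]

lemma DSa_eq_of_mem {n : ℕ} {S : Finset (Fin n)} (a : ℕ) {i k : Fin n} (hi : i ∈ S)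
    (hk : k ∈ S) : DSa S a i = DSa S a k := by
  rw [DSa_eq_prod_signedDiag a hi, DSa_eq_prod_signedDiag a hk, ← prod_signedDiag_eq hi hk,
    ← Finset.mul_prod_erase S _ hk]
  linear_combination (∏ j ∈ S.erase k, signedDiag i j) *
    signedDiag_mul_psiCl_pow i k (a + 1 - S.card)

lemma prod_signedDiag_mul_prod {n : ℕ} {U V : Finset (Fin n)} (hUV : U ⊆ V) {c : Fin n}
    (hc : c ∉ U) :
    (∏ j ∈ V, signedDiag c j) * ∏ j ∈ U, signedDiag c j =
      (∏ j ∈ V, signedDiag c j) * psiCl c ^ U.card := by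
  induction U using Finset.induction_on with
  | empty => simp
  | insert x U hx ih =>
    simp only [Finset.mem_insert, not_or] at hc
    have hx' : x ∈ V := hUV (Finset.mem_insert_self x U)
    have ih' := ih ((Finset.subset_insert x U).trans hUV) hc.2
    rw [Finset.prod_insert hx, Finset.card_insert_of_notMem hx, pow_succ]
    rw [← Finset.mul_prod_erase V _ hx'] at ih' ⊢
    linear_combination signedDiag c x * ih' +
      (∏ j ∈ V.erase x, signedDiag c j) * psiCl c ^ U.card * signedDiag_mul_self hc.1

/-- In `R_n`, for all nonempty `S, T ⊆ {1,…,n}` with `S ∩ T ≠ ∅` and all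
`a ≥ |S|−1`, `b ≥ |T|−1`, one has `D_{S,a} · D_{T,b} = D_{S∪T, a+b}` (for any choices of the
defining indices `i ∈ S`, `j ∈ T`, `k ∈ S ∪ T`). -/
theorem DSa_mul_DSa {n : ℕ} (S T : Finset (Fin n)) (hST : (S ∩ T).Nonempty)
    (a b : ℕ) (ha : S.card - 1 ≤ a) (hb : T.card - 1 ≤ b)
    (i : Fin n) (hi : i ∈ S) (j : Fin n) (hj : j ∈ T) (k : Fin n) (hk : k ∈ S ∪ T) :
    DSa S a i * DSa T b j = DSa (S ∪ T) (a + b) k := by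
  obtain ⟨c, hc⟩ := hST
  have hcS := Finset.mem_of_mem_inter_left hc
  have hcT := Finset.mem_of_mem_inter_right hc
  have hcU : c ∈ S ∪ T := Finset.mem_union_left T hcS
  rw [DSa_eq_of_mem a hi hcS, DSa_eq_of_mem b hj hcT, DSa_eq_of_mem (a + b) hk hcU,
    DSa_eq_prod_signedDiag a hcS, DSa_eq_prod_signedDiag b hcT,
    DSa_eq_prod_signedDiag (a + b) hcU]
  have hprod : (∏ l ∈ S, signedDiag c l) * ∏ l ∈ T, signedDiag c l =
      (∏ l ∈ S ∪ T, signedDiag c l) * psiCl c ^ ((S ∩ T).card - 1) := by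
    rw [← Finset.prod_union_inter, ← Finset.mul_prod_erase (S ∩ T) _ hc,
      ← Finset.card_erase_of_mem hc, ← prod_signedDiag_mul_prod _ (Finset.notMem_erase c _)]
    · simp [signedDiag]
    · exact (Finset.erase_subset c _).trans
        (Finset.inter_subset_left.trans Finset.subset_union_left)
  have hexp : a + b + 1 - (S ∪ T).card =
      ((S ∩ T).card - 1) + (a + 1 - S.card) + (b + 1 - T.card) := by
    have h1 := Finset.card_union_add_card_inter S T
    have h2 := Finset.card_pos.mpr ⟨c, hc⟩
    have h3 := Finset.card_pos.mpr ⟨c, hcS⟩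
    have h4 := Finset.card_pos.mpr ⟨c, hcT⟩
    omega
  rw [hexp, pow_add, pow_add]
  linear_combination psiCl c ^ (a + 1 - S.card) * psiCl c ^ (b + 1 - T.card) * hprod
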